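/- arXiv:1503.07054 — 2 statements merged into one kernel-verified Lean document; each statement's English description precedes it below -/
import Mathlib

section
/- Let A = U Σ Vᵀ be an SVD of a real m×n matrix A and let 1 ≤ r ≤ rank(A). Then as X ranges over all m×n matrices of rank at most r, the minimum of ‖A − X‖² equals σ_{r+1}² + σ_{r+2}² + … + σ_{min(m,n)}², the sum of the squares of the singular values of A beyond the r-th. -/
open Matrix

/-- The orthogonal projection onto the column space of `Y`, as a matrix: it fixes `Y` and its trace
is the rank of `Y`. -/
theorem exists_columnSpace_projection {m n : ℕ} (Y : Matrix (Fin m) (Fin n) ℝ) :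
    ∃ P : Matrix (Fin m) (Fin m) ℝ, Pᵀ = P ∧ P * P = P ∧ P * Y = Y ∧ P.trace = Y.rank := by
  let K : Submodule ℝ (EuclideanSpace ℝ (Fin m)) := LinearMap.range (Matrix.toEuclideanLin Y)
  let φ := LinearMap.toMatrixOrthonormal (EuclideanSpace.basisFun (Fin m) ℝ)
  let p : EuclideanSpace ℝ (Fin m) →ₗ[ℝ] EuclideanSpace ℝ (Fin m) := K.starProjection.toLinearMap
  have hproj : LinearMap.IsProj K p :=
    ⟨fun x => K.starProjection_apply_mem x, fun x hx => Submodule.starProjection_eq_self_iff.2 hx⟩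
  have hsymm : p.IsSymmetric := K.starProjection_isSymmetric
  refine ⟨φ p, ?_, ?_, ?_, ?_⟩
  · have h : star p = p := (LinearMap.isSymmetric_iff_isSelfAdjoint p).1 hsymm
    have := map_star φ p
    rw [h, Matrix.star_eq_conjTranspose, Matrix.conjTranspose_eq_transpose_of_trivial] at this
    exact this.symm
  · rw [← map_mul]
    congr 1
    ext1 x
    exact hproj.map_id _ (hproj.map_mem x)
  · ext i j
    have hmem : WithLp.toLp 2 (Y.col j) ∈ K :=
      ⟨WithLp.toLp 2 (Pi.single j 1), by simp [Matrix.toLpLin_apply]⟩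
    have h := congrArg (fun v => v i) (hproj.map_id _ hmem)
    have h2 := LinearMap.toMatrix_mulVec_repr (EuclideanSpace.basisFun (Fin m) ℝ).toBasis
      (EuclideanSpace.basisFun (Fin m) ℝ).toBasis p (WithLp.toLp 2 (Y.col j))
    have h3 := congrFun h2 i
    simp only [OrthonormalBasis.coe_toBasis_repr_apply, EuclideanSpace.basisFun_repr] at h3
    exact h3.trans h
  · have h1 : LinearMap.trace ℝ _ p = Module.finrank ℝ K := hproj.trace
    have h2 : LinearMap.trace ℝ _ p = (φ p).trace :=
      LinearMap.trace_eq_matrix_trace ℝ (EuclideanSpace.basisFun (Fin m) ℝ).toBasis p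
    rw [← h2, h1, Matrix.rank_eq_finrank_range_toLin Y
      (EuclideanSpace.basisFun (Fin m) ℝ).toBasis (EuclideanSpace.basisFun (Fin n) ℝ).toBasis]
    rfl

theorem trace_mul_transpose_self_eq_sum {m n : ℕ} (M : Matrix (Fin m) (Fin n) ℝ) :
    (M * Mᵀ).trace = ∑ i, ∑ j, M i j ^ 2 := by
  simp [Matrix.trace, Matrix.mul_apply, sq]

/-- The Frobenius norm is invariant under orthogonal changes of bases. -/
theorem trace_orthogonal_mul_mul {m n : ℕ} {U : Matrix (Fin m) (Fin m) ℝ}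
    {V : Matrix (Fin n) (Fin n) ℝ} (hU : U * Uᵀ = 1) (hV : V * Vᵀ = 1)
    (M : Matrix (Fin m) (Fin n) ℝ) :
    ((U * M * Vᵀ) * (U * M * Vᵀ)ᵀ).trace = (M * Mᵀ).trace := by
  have hU' : Uᵀ * U = 1 := mul_eq_one_comm.1 hU
  have hV' : Vᵀ * V = 1 := mul_eq_one_comm.1 hV
  have h : (U * M * Vᵀ) * (U * M * Vᵀ)ᵀ = U * (M * (Vᵀ * V) * Mᵀ * Uᵀ) := by
    simp only [Matrix.transpose_mul, Matrix.transpose_transpose, Matrix.mul_assoc]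
  rw [h, Matrix.trace_mul_comm, hV', Matrix.mul_one, Matrix.mul_assoc, hU', Matrix.mul_one]

/-- A weighted sum of an antitone nonnegative sequence with weights in `[0, 1]` of total at least
the number of indices beyond `r` dominates the tail sum beyond `r`. -/
theorem tail_sum_le_weighted_sum {m r : ℕ} (D p : Fin m → ℝ) (hD0 : ∀ i, 0 ≤ D i)
    (hD : Antitone D) (hp0 : ∀ i, 0 ≤ p i) (hp1 : ∀ i, p i ≤ 1) (hp : ∑ i, p i ≤ r) :
    ∑ i ∈ Finset.univ.filter (fun i : Fin m => r ≤ (i : ℕ)), D i ≤ ∑ i, (1 - p i) * D i := by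
  rw [Finset.sum_filter]
  rcases le_or_gt m r with hr | hr
  · rw [Finset.sum_eq_zero fun i _ => if_neg (by have := i.2; omega)]
    exact Finset.sum_nonneg fun i _ => mul_nonneg (sub_nonneg.2 (hp1 i)) (hD0 i)
  · let c := D ⟨r, hr⟩
    have hcount : ∑ i : Fin m, (if r ≤ (i : ℕ) then (0 : ℝ) else 1) = r := by
      have : (Finset.univ.filter fun i : Fin m => ¬ r ≤ (i : ℕ)) = Finset.Iio ⟨r, hr⟩ := by
        ext i
        simp [Fin.lt_def]
      simp_rw [← ite_not (r ≤ _), ← Finset.sum_filter, this]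
      simp
    have hterm : ∀ i : Fin m, (if r ≤ (i : ℕ) then D i else 0)
        + c * ((if r ≤ (i : ℕ) then 0 else 1) - p i) ≤ (1 - p i) * D i := by
      intro i
      split_ifs with h
      · have : D i ≤ c := hD (Fin.le_def.2 h)
        nlinarith [hp0 i]
      · have : c ≤ D i := hD (Fin.le_def.2 (le_of_not_ge h))
        nlinarith [hp1 i]
    have hsum := Finset.sum_le_sum fun i (_ : i ∈ Finset.univ) => hterm i
    rw [Finset.sum_add_distrib, ← Finset.mul_sum, Finset.sum_sub_distrib, hcount] at hsum
    have := mul_nonneg (hD0 ⟨r, hr⟩) (sub_nonneg.2 hp)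
    linarith

/-- If the squared row norms of `S` decrease and its rows are pairwise orthogonal, the squared
Frobenius distance from `S` to a matrix of rank at most `r` is at least the tail sum. -/
theorem tail_sum_le_trace_sub {m n r : ℕ} (S Y : Matrix (Fin m) (Fin n) ℝ)
    (hS : (S * Sᵀ).IsDiag) (hD : Antitone fun i => ∑ j, S i j ^ 2) (hY : Y.rank ≤ r) :
    ∑ i ∈ Finset.univ.filter (fun i : Fin m => r ≤ (i : ℕ)),
      ∑ j, S i j ^ 2 ≤ ((S - Y) * (S - Y)ᵀ).trace := by
  obtain ⟨P, hPt, hPP, hPY, hPtr⟩ := exists_columnSpace_projection Y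
  have hdiag : ∀ i, P i i = ∑ j, P i j ^ 2 := fun i => by
    have h : P i i = (P * Pᵀ) i i := by rw [hPt, hPP]
    rw [h]
    simp [Matrix.mul_apply, sq]
  have hp0 : ∀ i, 0 ≤ P i i := fun i => hdiag i ▸ Finset.sum_nonneg fun j _ => sq_nonneg _
  have hp1 : ∀ i, P i i ≤ 1 := fun i => by
    have h : P i i ^ 2 ≤ P i i := by
      conv_rhs => rw [hdiag i]
      exact Finset.single_le_sum (f := fun j => P i j ^ 2) (fun j _ => sq_nonneg _)
        (Finset.mem_univ i)
    nlinarith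
  have hsplit : ∀ M : Matrix (Fin m) (Fin n) ℝ, (M * Mᵀ).trace
      = ((P * M) * (P * M)ᵀ).trace + (((1 - P) * M) * ((1 - P) * M)ᵀ).trace := fun M => by
    have hQ : (1 - P)ᵀ = 1 - P := by rw [Matrix.transpose_sub, hPt, Matrix.transpose_one]
    have hQQ : (1 - P) * (1 - P) = 1 - P := by
      simp [Matrix.sub_mul, Matrix.mul_sub, hPP]
    have key : ∀ R : Matrix (Fin m) (Fin m) ℝ, Rᵀ = R → R * R = R →
        ((R * M) * (R * M)ᵀ).trace = (R * (M * Mᵀ)).trace := fun R hR hRR => by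
      rw [Matrix.transpose_mul, hR, ← Matrix.mul_assoc, Matrix.trace_mul_comm,
        ← Matrix.mul_assoc, ← Matrix.mul_assoc, hRR, Matrix.mul_assoc]
    rw [key P hPt hPP, key (1 - P) hQ hQQ, ← Matrix.trace_add, ← Matrix.add_mul]
    simp
  have hnn : ∀ M : Matrix (Fin m) (Fin n) ℝ, 0 ≤ (M * Mᵀ).trace := fun M => by
    rw [trace_mul_transpose_self_eq_sum]
    positivity
  have hQS : (1 - P) * (S - Y) = (1 - P) * S := by
    simp [Matrix.sub_mul, Matrix.mul_sub, hPY]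
  have hPS : ((P * S) * (P * S)ᵀ).trace = ∑ i, P i i * ∑ j, S i j ^ 2 := by
    rw [Matrix.transpose_mul, hPt, ← Matrix.mul_assoc, Matrix.trace_mul_comm,
      ← Matrix.mul_assoc, ← Matrix.mul_assoc, hPP, Matrix.mul_assoc]
    refine Finset.sum_congr rfl fun i _ => ?_
    rw [Matrix.diag_apply, Matrix.mul_apply, Finset.sum_eq_single i]
    · simp [Matrix.mul_apply, sq]
    · intro k _ hk
      rw [hS hk, mul_zero]
    · simp
  calc ∑ i ∈ Finset.univ.filter (fun i : Fin m => r ≤ (i : ℕ)), ∑ j, S i j ^ 2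
      ≤ ∑ i, (1 - P i i) * ∑ j, S i j ^ 2 := by
        refine tail_sum_le_weighted_sum _ _ (fun i => by positivity) hD hp0 hp1 ?_
        exact hPtr.le.trans (by exact_mod_cast hY)
    _ = (((1 - P) * S) * ((1 - P) * S)ᵀ).trace := by
        have h := hsplit S
        rw [hPS, trace_mul_transpose_self_eq_sum] at h
        simp only [sub_mul, one_mul, Finset.sum_sub_distrib]
        linarith
    _ ≤ ((S - Y) * (S - Y)ᵀ).trace := by
        rw [hsplit (S - Y), hQS]
        linarith [hnn (P * (S - Y))]

/-- Keeping the first `r` rows of `S` gives a matrix of rank at most `r`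
whose squared distance to `S` is the tail sum. -/
theorem exists_rank_le_trace_sub_eq {m n : ℕ} (S : Matrix (Fin m) (Fin n) ℝ) (r : ℕ) :
    ∃ T : Matrix (Fin m) (Fin n) ℝ, T.rank ≤ r ∧
      ((S - T) * (S - T)ᵀ).trace =
        ∑ i ∈ Finset.univ.filter (fun i : Fin m => r ≤ (i : ℕ)), ∑ j, S i j ^ 2 := by
  let w : Fin m → ℝ := fun i => if (i : ℕ) < r then 1 else 0
  refine ⟨Matrix.diagonal w * S, (Matrix.rank_mul_le_left _ _).trans ?_, ?_⟩
  · rw [Matrix.rank_diagonal]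
    refine (Fintype.card_le_of_injective
      (fun i : {i // w i ≠ 0} => (⟨i.1, ?_⟩ : Fin r)) ?_).trans (Fintype.card_fin r).le
    · by_contra h
      exact i.2 (if_neg h)
    · intro a b h
      exact Subtype.ext (Fin.ext (by simpa using h))
  · rw [trace_mul_transpose_self_eq_sum, Finset.sum_filter]
    refine Finset.sum_congr rfl fun i _ => ?_
    by_cases h : r ≤ (i : ℕ)
    · simp [w, Matrix.diagonal_mul, h, not_lt.2 h]
    · simp [w, Matrix.diagonal_mul, h, not_le.1 h]



/-- If `A = U S Vᵀ` is an SVD of `A` and `1 ≤ r ≤ rank A`, the minimum of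
`‖A - X‖²` over matrices `X` of rank at most `r` equals the sum of the squares
of the singular values of `A` beyond the `r`-th. -/
theorem eckart_young_min_value {m n : ℕ}
    (A : Matrix (Fin m) (Fin n) ℝ) (U : Matrix (Fin m) (Fin m) ℝ)
    (V : Matrix (Fin n) (Fin n) ℝ) (S : Matrix (Fin m) (Fin n) ℝ)
    (hU : U * Uᵀ = 1) (hV : V * Vᵀ = 1)
    (hdiag : ∀ (i : Fin m) (j : Fin n), (i : ℕ) ≠ (j : ℕ) → S i j = 0)
    (hnonneg : ∀ (i : Fin m) (j : Fin n), (i : ℕ) = (j : ℕ) → 0 ≤ S i j)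
    (hord : ∀ (i i' : Fin m) (j j' : Fin n), (i : ℕ) = (j : ℕ) → (i' : ℕ) = (j' : ℕ) →
      (i : ℕ) ≤ (i' : ℕ) → S i' j' ≤ S i j)
    (hA : A = U * S * Vᵀ)
    (r : ℕ) (hr1 : 1 ≤ r) (hr2 : r ≤ A.rank) :
    IsLeast {d : ℝ | ∃ X : Matrix (Fin m) (Fin n) ℝ, X.rank ≤ r ∧
        d = Matrix.trace ((A - X) * (A - X)ᵀ)}
      (∑ i ∈ Finset.univ.filter (fun i : Fin (min m n) => r ≤ (i : ℕ)),
        (S (Fin.castLE (Nat.min_le_left m n) i) (Fin.castLE (Nat.min_le_right m n) i)) ^ 2) := by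
  have hrow : ∀ (i : Fin m) (j : Fin n), (i : ℕ) = j → ∑ k, S i k ^ 2 = S i j ^ 2 := by
    intro i j hij
    refine Finset.sum_eq_single j (fun k _ hk => ?_) (by simp)
    rw [hdiag i k fun h => hk (Fin.ext (h.symm.trans hij)), sq, mul_zero]
  have hrow0 : ∀ i : Fin m, n ≤ (i : ℕ) → ∑ k, S i k ^ 2 = 0 := by
    intro i hi
    refine Finset.sum_eq_zero fun k _ => ?_
    rw [hdiag i k (by have := k.2; omega), sq, mul_zero]
  have hsum : ∑ i ∈ Finset.univ.filter (fun i : Fin (min m n) => r ≤ (i : ℕ)),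
      (S (Fin.castLE (Nat.min_le_left m n) i) (Fin.castLE (Nat.min_le_right m n) i)) ^ 2
      = ∑ i ∈ Finset.univ.filter (fun i : Fin m => r ≤ (i : ℕ)), ∑ j, S i j ^ 2 := by
    refine Finset.sum_of_injOn (Fin.castLE (Nat.min_le_left m n))
      (Fin.castLE_injective _).injOn ?_ ?_ ?_
    · intro i hi
      simpa using hi
    · intro i hi hi'
      refine hrow0 i (le_of_not_gt fun hn => hi' ?_)
      exact ⟨⟨i, lt_min i.2 hn⟩, by simpa using hi, rfl⟩
    · intro i _
      exact (hrow _ _ rfl).symm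
  have hanti : Antitone fun i => ∑ j, S i j ^ 2 := by
    intro i i' hi
    have hi : (i : ℕ) ≤ i' := hi
    rcases lt_or_ge (i' : ℕ) n with hn | hn
    · have hle := hord i i' ⟨i, hi.trans_lt hn⟩ ⟨i', hn⟩ rfl rfl hi
      have h0 := hnonneg i' ⟨i', hn⟩ rfl
      simp only [hrow i ⟨i, hi.trans_lt hn⟩ rfl, hrow i' ⟨i', hn⟩ rfl]
      gcongr
    · simp only [hrow0 i' hn]
      positivity
  have horth : (S * Sᵀ).IsDiag := by
    intro i k hik
    rw [Matrix.mul_apply]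
    refine Finset.sum_eq_zero fun j _ => ?_
    by_cases h : (i : ℕ) = j
    · rw [Matrix.transpose_apply, hdiag k j fun h' => hik (Fin.ext (h.trans h'.symm)), mul_zero]
    · rw [hdiag i j h, zero_mul]
  rw [hsum]
  constructor
  · obtain ⟨T, hT, hST⟩ := exists_rank_le_trace_sub_eq S r
    refine ⟨U * T * Vᵀ, ?_, ?_⟩
    · exact (Matrix.rank_mul_le_left _ _).trans ((Matrix.rank_mul_le_right _ _).trans hT)
    · rw [hA, ← Matrix.sub_mul, ← Matrix.mul_sub, trace_orthogonal_mul_mul hU hV, hST]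
  · rintro d ⟨X, hX, rfl⟩
    have hrank : (Uᵀ * X * V).rank ≤ r :=
      (Matrix.rank_mul_le_left _ _).trans ((Matrix.rank_mul_le_right _ _).trans hX)
    have hX' : U * (Uᵀ * X * V) * Vᵀ = X := by
      calc U * (Uᵀ * X * V) * Vᵀ = (U * Uᵀ) * X * (V * Vᵀ) := by
            simp only [Matrix.mul_assoc]
        _ = X := by rw [hU, hV, Matrix.one_mul, Matrix.mul_one]
    have heq : A - X = U * (S - Uᵀ * X * V) * Vᵀ := by
      rw [Matrix.mul_sub, Matrix.sub_mul, hX', hA]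
    rw [heq, trace_orthogonal_mul_mul hU hV]
    exact tail_sum_le_trace_sub S _ horth hanti hrank
end

section
/- (Eckart–Young revisited, converse and count) Let A = U Σ Vᵀ be an SVD of a real m×n matrix A whose nonzero singular values are pairwise distinct, and let 1 ≤ r ≤ rank(A). If B is an m×n matrix of rank exactly r with (A − B)ᵀ B = 0 and (A − B) Bᵀ = 0, then B = U Σ_S Vᵀ for some subset S ⊆ {1,…,rank(A)} with |S| = r. Consequently the set of such critical points B has exactly binomial(rank(A), r) elements. -/
open Matrix

/-- The truncation of the pseudodiagonal matrix `S` keeping only the diagonal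
entries with index in the set `T` (0-indexed). -/
def sigmaTrunc {m n : ℕ} (S : Matrix (Fin m) (Fin n) ℝ) (T : Finset ℕ) :
    Matrix (Fin m) (Fin n) ℝ :=
  Matrix.of fun i j => if (i : ℕ) = (j : ℕ) ∧ (i : ℕ) ∈ T then S i j else 0

/-- The rectangular diagonal matrix with diagonal entries given by a sequence. -/
def rectDiag (m n : ℕ) (d : ℕ → ℝ) : Matrix (Fin m) (Fin n) ℝ :=
  Matrix.of fun i j => if (i : ℕ) = (j : ℕ) then d i else 0

/-- The extension by zero of a matrix to all pairs of natural number indices. -/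
def zeroExtend {m n : ℕ} (M : Matrix (Fin m) (Fin n) ℝ) (i j : ℕ) : ℝ :=
  if h : i < m ∧ j < n then M ⟨i, h.1⟩ ⟨j, h.2⟩ else 0

lemma zeroExtend_apply {m n : ℕ} (M : Matrix (Fin m) (Fin n) ℝ) (i : Fin m) (j : Fin n) :
    zeroExtend M i j = M i j := by
  simp [zeroExtend]

lemma zeroExtend_eq_zero {m n : ℕ} (M : Matrix (Fin m) (Fin n) ℝ) {i j : ℕ}
    (h : ¬(i < m ∧ j < n)) : zeroExtend M i j = 0 := by
  simp only [zeroExtend, dif_neg h]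

lemma rectDiag_transpose (m n : ℕ) (d : ℕ → ℝ) : (rectDiag m n d)ᵀ = rectDiag n m d := by
  ext i j
  simp only [rectDiag, transpose_apply, of_apply, eq_comm (a := (j : ℕ))]
  split_ifs with h <;> simp [h]

lemma rectDiag_mul_apply {m n l : ℕ} (d : ℕ → ℝ) (M : Matrix (Fin n) (Fin l) ℝ)
    (i : Fin m) (k : Fin l) : (rectDiag m n d * M) i k = d i * zeroExtend M i k := by
  rw [mul_apply]
  by_cases h : (i : ℕ) < n
  · rw [Finset.sum_eq_single ⟨i, h⟩]
    · simp [rectDiag, zeroExtend, h]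
    · intro j _ hj
      have : (i : ℕ) ≠ j := fun e => hj (Fin.ext e.symm)
      simp [rectDiag, this]
    · simp
  · rw [zeroExtend_eq_zero M (fun h' => h h'.1), mul_zero]
    refine Finset.sum_eq_zero fun j _ => ?_
    have : (i : ℕ) ≠ j := fun e => h (e ▸ j.2)
    simp [rectDiag, this]

lemma rectDiag_mul_rectDiag_eq_zero {m n l : ℕ} {d e : ℕ → ℝ} (h : ∀ k, d k * e k = 0) :
    rectDiag m n d * rectDiag n l e = 0 := by
  ext i k
  rw [rectDiag_mul_apply, zeroExtend, Matrix.zero_apply]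
  split_ifs with hik
  · simp only [rectDiag, of_apply]
    split_ifs <;> simp [h]
  · simp

lemma rank_rectDiag (m n : ℕ) (d : ℕ → ℝ) :
    (rectDiag m n d).rank = ((Finset.range (min m n)).filter (fun k => d k ≠ 0)).card := by
  have hdiag : (rectDiag m n d)ᵀ * rectDiag m n d =
      diagonal (fun j : Fin n => if (j : ℕ) < m then d j * d j else 0) := by
    ext i k
    rw [rectDiag_transpose, rectDiag_mul_apply, diagonal_apply, zeroExtend]
    by_cases hi : (i : ℕ) < m <;> by_cases hik : i = k <;>
      simp_all [rectDiag, Fin.ext_iff]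
  rw [← rank_transpose_mul_self, hdiag, rank_diagonal, Fintype.card_subtype]
  refine Finset.card_bij (fun j _ => (j : ℕ)) ?_ ?_ ?_
  · intro j hj
    have := j.2
    simp_all
  · intro a _ b _ h
    exact Fin.ext h
  · intro k hk
    simp only [Finset.mem_filter, Finset.mem_range, lt_min_iff] at hk
    exact ⟨⟨k, hk.1.2⟩, by simp [hk], rfl⟩

/-- Critical points of the distance from a diagonal matrix with distinct nonzero entries are
obtained by deleting diagonal entries. -/
lemma eq_rectDiag_of_critical {m n : ℕ} {s : ℕ → ℝ} (hs : ∀ k, 0 ≤ s k)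
    (hinj : ∀ i j, i ≠ j → s i ≠ 0 → s i ≠ s j)
    {C : Matrix (Fin m) (Fin n) ℝ} (h₁ : (rectDiag m n s)ᵀ * C = Cᵀ * C)
    (h₂ : rectDiag m n s * Cᵀ = C * Cᵀ) :
    C = rectDiag m n (fun k => if zeroExtend C k k ≠ 0 then s k else 0) := by
  rw [rectDiag_transpose] at h₁
  have e₁ (j k : Fin n) : s j * zeroExtend C j k = ∑ i, C i j * C i k := by
    rw [← rectDiag_mul_apply s C j k, h₁, mul_apply]
    rfl
  have e₂ (i k : Fin m) : s i * zeroExtend C k i = ∑ j, C i j * C k j := by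
    have ht : zeroExtend Cᵀ i k = zeroExtend C k i := by
      simp [zeroExtend, and_comm]
    rw [← ht, ← rectDiag_mul_apply s Cᵀ i k, h₂, mul_apply]
    rfl
  have offdiag (i : Fin m) (j : Fin n) (hij : (i : ℕ) ≠ j) : C i j = 0 := by
    by_cases hz : s j = 0
    · have h := e₁ j j
      rw [hz, zero_mul, eq_comm, Finset.sum_eq_zero_iff_of_nonneg
        (fun i _ => mul_self_nonneg _)] at h
      exact mul_self_eq_zero.mp (h i (Finset.mem_univ i))
    · have f₁ : s i * zeroExtend C i j = s j * zeroExtend C j i := by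
        by_cases hi : (i : ℕ) < n
        · have a := e₁ ⟨i, hi⟩ j
          have b := e₁ j ⟨i, hi⟩
          simp only [mul_comm (C _ j)] at b
          exact a.trans b.symm
        · have h := e₂ i i
          rw [zeroExtend_eq_zero C (fun h' => hi h'.2), mul_zero, eq_comm,
            Finset.sum_eq_zero_iff_of_nonneg (fun j _ => mul_self_nonneg _)] at h
          rw [zeroExtend_apply, mul_self_eq_zero.mp (h j (Finset.mem_univ j)),
            zeroExtend_eq_zero C (fun h' => hi h'.2)]
          simp
      have f₂ : s j * zeroExtend C i j = s i * zeroExtend C j i := by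
        by_cases hj : (j : ℕ) < m
        · have a := e₂ ⟨j, hj⟩ i
          have b := e₂ i ⟨j, hj⟩
          simp only [mul_comm (C i _)] at b
          exact a.trans b.symm
        · have h := e₁ j j
          rw [zeroExtend_eq_zero C (fun h' => hj h'.1), mul_zero, eq_comm,
            Finset.sum_eq_zero_iff_of_nonneg (fun i _ => mul_self_nonneg _)] at h
          rw [zeroExtend_apply, mul_self_eq_zero.mp (h i (Finset.mem_univ i)),
            zeroExtend_eq_zero C (fun h' => hj h'.1)]
          simp
      rw [zeroExtend_apply] at f₁ f₂
      have hsq : (s j - s i) * ((s j + s i) * C i j) = 0 := by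
        linear_combination s j * f₂ - s i * f₁
      have hne : s j - s i ≠ 0 := sub_ne_zero.mpr (hinj j i hij.symm hz)
      have hpos : 0 < s j + s i :=
        add_pos_of_pos_of_nonneg (lt_of_le_of_ne (hs j) (Ne.symm hz)) (hs i)
      simpa [hne, hpos.ne'] using hsq
  ext i j
  simp only [rectDiag, of_apply]
  split_ifs with hij hc
  · have h := e₁ j j
    rw [Finset.sum_eq_single i] at h
    · rw [hij] at hc ⊢
      have hz : zeroExtend C j j = C i j := by
        rw [← zeroExtend_apply C i j, hij]
      rw [hz] at h hc
      exact (mul_right_cancel₀ hc h).symm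
    · intro i' _ hi'
      rw [offdiag i' j (fun e => hi' (Fin.ext (e.trans hij.symm))), mul_zero]
    · simp
  · rw [not_not] at hc
    rw [← zeroExtend_apply C i j, ← hij, hc]
  · exact offdiag i j hij

lemma rank_mul_mul_transpose_of_orthogonal {m n : ℕ} {U : Matrix (Fin m) (Fin m) ℝ}
    {V : Matrix (Fin n) (Fin n) ℝ} (hU : U * Uᵀ = 1) (hV : V * Vᵀ = 1)
    (M : Matrix (Fin m) (Fin n) ℝ) : (U * M * Vᵀ).rank = M.rank := by
  rw [rank_mul_eq_left_of_isUnit_det _ _ (isUnit_det_of_left_inverse hV),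
    rank_mul_eq_right_of_isUnit_det _ _ (isUnit_det_of_right_inverse hU)]

lemma transpose_mul_sandwich {m n : ℕ} {U : Matrix (Fin m) (Fin m) ℝ}
    (hU : U * Uᵀ = 1) (V : Matrix (Fin n) (Fin n) ℝ) (M N : Matrix (Fin m) (Fin n) ℝ) :
    (U * M * Vᵀ)ᵀ * (U * N * Vᵀ) = V * (Mᵀ * N) * Vᵀ := by
  have hU' : Uᵀ * U = 1 := mul_eq_one_comm.mp hU
  calc (U * M * Vᵀ)ᵀ * (U * N * Vᵀ) = V * Mᵀ * (Uᵀ * U) * N * Vᵀ := by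
        simp only [transpose_mul, transpose_transpose, Matrix.mul_assoc]
    _ = V * (Mᵀ * N) * Vᵀ := by
        rw [hU', Matrix.mul_one, Matrix.mul_assoc V]

lemma mul_transpose_sandwich {m n : ℕ} (U : Matrix (Fin m) (Fin m) ℝ)
    {V : Matrix (Fin n) (Fin n) ℝ} (hV : V * Vᵀ = 1) (M N : Matrix (Fin m) (Fin n) ℝ) :
    (U * M * Vᵀ) * (U * N * Vᵀ)ᵀ = U * (M * Nᵀ) * Uᵀ := by
  have hV' : Vᵀ * V = 1 := mul_eq_one_comm.mp hV
  calc (U * M * Vᵀ) * (U * N * Vᵀ)ᵀ = U * M * (Vᵀ * V) * Nᵀ * Uᵀ := by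
        simp only [transpose_mul, transpose_transpose, Matrix.mul_assoc]
    _ = U * (M * Nᵀ) * Uᵀ := by
        rw [hV', Matrix.mul_one, Matrix.mul_assoc U]

lemma sandwich_injective {m n : ℕ} {U : Matrix (Fin m) (Fin m) ℝ}
    {V : Matrix (Fin n) (Fin n) ℝ} (hU : U * Uᵀ = 1) (hV : V * Vᵀ = 1) :
    Function.Injective fun M : Matrix (Fin m) (Fin n) ℝ => U * M * Vᵀ := by
  have hU' : Uᵀ * U = 1 := mul_eq_one_comm.mp hU
  have hV' : Vᵀ * V = 1 := mul_eq_one_comm.mp hV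
  refine Function.LeftInverse.injective (g := fun N => Uᵀ * N * V) fun M => ?_
  calc Uᵀ * (U * M * Vᵀ) * V = (Uᵀ * U) * M * (Vᵀ * V) := by
        simp only [Matrix.mul_assoc]
    _ = M := by rw [hU', hV', Matrix.one_mul, Matrix.mul_one]

/-- A set of natural numbers closed downwards is an initial segment. -/
lemma Finset.eq_range_card_of_isLowerSet {F : Finset ℕ} (h : IsLowerSet (F : Set ℕ)) :
    F = Finset.range F.card := by
  refine Finset.eq_of_subset_of_card_le (fun k hk => ?_) (by simp)
  have : Finset.range (k + 1) ⊆ F := fun i hi =>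
    h (Nat.lt_succ_iff.mp (Finset.mem_range.mp hi)) hk
  simpa using Finset.card_le_card this

/-- Eckart–Young revisited, converse and count: if the nonzero singular values of `A`
are pairwise distinct, every rank-`r` critical point `B` of the distance from `A` to
the matrices of rank ≤ r is of the form `U S_T Vᵀ` for an `r`-element subset `T` of
`{0,…,rank A - 1}` (0-indexed), and there are exactly `choose (rank A) r` such
critical points. -/
theorem eckart_young_critical_points_converse {m n : ℕ}
    (A : Matrix (Fin m) (Fin n) ℝ) (U : Matrix (Fin m) (Fin m) ℝ)
    (V : Matrix (Fin n) (Fin n) ℝ) (S : Matrix (Fin m) (Fin n) ℝ)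
    (hU : U * Uᵀ = 1) (hV : V * Vᵀ = 1)
    (hdiag : ∀ (i : Fin m) (j : Fin n), (i : ℕ) ≠ (j : ℕ) → S i j = 0)
    (hnonneg : ∀ (i : Fin m) (j : Fin n), (i : ℕ) = (j : ℕ) → 0 ≤ S i j)
    (hord : ∀ (i i' : Fin m) (j j' : Fin n), (i : ℕ) = (j : ℕ) → (i' : ℕ) = (j' : ℕ) →
      (i : ℕ) ≤ (i' : ℕ) → S i' j' ≤ S i j)
    (hA : A = U * S * Vᵀ)
    (hdistinct : ∀ i j : Fin (min m n), i ≠ j →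
      S (Fin.castLE (Nat.min_le_left m n) i) (Fin.castLE (Nat.min_le_right m n) i) ≠ 0 →
      S (Fin.castLE (Nat.min_le_left m n) j) (Fin.castLE (Nat.min_le_right m n) j) ≠ 0 →
      S (Fin.castLE (Nat.min_le_left m n) i) (Fin.castLE (Nat.min_le_right m n) i) ≠
        S (Fin.castLE (Nat.min_le_left m n) j) (Fin.castLE (Nat.min_le_right m n) j))
    (r : ℕ) (hr1 : 1 ≤ r) (hr2 : r ≤ A.rank) :
    (∀ B : Matrix (Fin m) (Fin n) ℝ, B.rank = r →
      (A - B)ᵀ * B = 0 → (A - B) * Bᵀ = 0 →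
      ∃ T : Finset ℕ, (∀ k ∈ T, k < A.rank) ∧ T.card = r ∧ B = U * sigmaTrunc S T * Vᵀ) ∧
    Set.ncard {B : Matrix (Fin m) (Fin n) ℝ |
        B.rank = r ∧ (A - B)ᵀ * B = 0 ∧ (A - B) * Bᵀ = 0} = (A.rank).choose r := by
  set s : ℕ → ℝ := fun k => zeroExtend S k k with hs_def
  have hS : S = rectDiag m n s := by
    ext i j
    simp only [rectDiag, of_apply]
    split_ifs with h
    · rw [hs_def, ← zeroExtend_apply S i j, h]
    · exact hdiag i j h
  have hs0 (k : ℕ) : 0 ≤ s k := by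
    simp only [hs_def, zeroExtend]
    split_ifs
    · exact hnonneg _ _ rfl
    · exact le_rfl
  have hsupp (k : ℕ) (hk : s k ≠ 0) : k < m ∧ k < n := by
    by_contra h
    exact hk (zeroExtend_eq_zero S h)
  have hs_apply (k : ℕ) (h : k < m ∧ k < n) : s k = S ⟨k, h.1⟩ ⟨k, h.2⟩ := dif_pos h
  have hinj (i j : ℕ) (hij : i ≠ j) (hi : s i ≠ 0) : s i ≠ s j := by
    intro he
    have hj : s j ≠ 0 := he ▸ hi
    have hi' := hsupp i hi
    have hj' := hsupp j hj
    rw [hs_apply i hi'] at hi he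
    rw [hs_apply j hj'] at hj he
    exact hdistinct ⟨i, lt_min hi'.1 hi'.2⟩ ⟨j, lt_min hj'.1 hj'.2⟩
      (fun h => hij (congrArg Fin.val h)) hi hj he
  have hrank : A.rank = ((Finset.range (min m n)).filter (fun k => s k ≠ 0)).card := by
    rw [hA, rank_mul_mul_transpose_of_orthogonal hU hV, ← rank_rectDiag, ← hS]
  have hmem (k : ℕ) : k < A.rank ↔ s k ≠ 0 := by
    have hlow : IsLowerSet
        ((Finset.range (min m n)).filter (fun k => s k ≠ 0) : Set ℕ) := by
      intro a b hba ha
      simp only [Finset.coe_filter, Finset.mem_range, Set.mem_ofPred_eq, lt_min_iff] at ha ⊢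
      have hb : b < m ∧ b < n := ⟨hba.trans_lt ha.1.1, hba.trans_lt ha.1.2⟩
      refine ⟨hb, ?_⟩
      have hle : s a ≤ s b := by
        rw [hs_apply a ha.1, hs_apply b hb]
        exact hord _ _ _ _ rfl rfl hba
      exact ((lt_of_le_of_ne (hs0 a) ha.2.symm).trans_le hle).ne'
    rw [hrank, ← Finset.mem_range, ← Finset.eq_range_card_of_isLowerSet hlow]
    simp only [Finset.mem_filter, Finset.mem_range, lt_min_iff, and_iff_right_iff_imp]
    exact hsupp k
  have htrunc (T : Finset ℕ) :
      sigmaTrunc S T = rectDiag m n (fun k => if k ∈ T then s k else 0) := by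
    ext i j
    have hij : S i j = if (i : ℕ) = j then s i else 0 := congrFun₂ hS i j
    simp only [sigmaTrunc, rectDiag, of_apply, hij, ite_and]
    split_ifs <;> rfl
  have hrankT (T : Finset ℕ) (hT : ∀ k ∈ T, k < A.rank) : (sigmaTrunc S T).rank = T.card := by
    rw [htrunc, rank_rectDiag]
    congr 1
    ext k
    simp only [Finset.mem_filter, Finset.mem_range, lt_min_iff, ne_eq, ite_eq_right_iff,
      Classical.not_imp]
    exact ⟨fun h => h.2.1, fun h =>
      ⟨hsupp k ((hmem k).mp (hT k h)), h, (hmem k).mp (hT k h)⟩⟩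
  have hconv : ∀ B : Matrix (Fin m) (Fin n) ℝ, B.rank = r →
      (A - B)ᵀ * B = 0 → (A - B) * Bᵀ = 0 →
      ∃ T : Finset ℕ, (∀ k ∈ T, k < A.rank) ∧ T.card = r ∧
        B = U * sigmaTrunc S T * Vᵀ := by
    intro B hB h₁ h₂
    obtain ⟨C, rfl⟩ : ∃ C : Matrix (Fin m) (Fin n) ℝ, B = U * C * Vᵀ := by
      refine ⟨Uᵀ * B * V, ?_⟩
      calc B = (U * Uᵀ) * B * (V * Vᵀ) := by rw [hU, hV, Matrix.one_mul, Matrix.mul_one]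
        _ = U * (Uᵀ * B * V) * Vᵀ := by simp only [Matrix.mul_assoc]
    have hsub : A - U * C * Vᵀ = U * (S - C) * Vᵀ := by
      rw [hA, Matrix.mul_sub, Matrix.sub_mul]
    rw [hsub, transpose_mul_sandwich hU] at h₁
    rw [hsub, mul_transpose_sandwich U hV] at h₂
    have g₁ : (S - C)ᵀ * C = 0 := sandwich_injective hV hV (by simpa using h₁)
    have g₂ : (S - C) * Cᵀ = 0 := sandwich_injective hU hU (by simpa using h₂)
    rw [transpose_sub, Matrix.sub_mul, sub_eq_zero, hS] at g₁
    rw [Matrix.sub_mul, sub_eq_zero, hS] at g₂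
    have hC := eq_rectDiag_of_critical hs0 hinj g₁ g₂
    set T := (Finset.range A.rank).filter (fun k => zeroExtend C k k ≠ 0) with hT
    have hTlt : ∀ k ∈ T, k < A.rank := by
      intro k hk
      exact Finset.mem_range.mp (Finset.mem_filter.mp hk).1
    have hCT : C = sigmaTrunc S T := by
      rw [htrunc]
      refine hC.trans (congrArg (rectDiag m n) (funext fun k => ?_))
      by_cases hk : s k = 0
      · simp [hk]
      · simp [hT, hmem, hk]
    refine ⟨T, hTlt, ?_, by rw [← hCT]⟩
    rw [← hrankT T hTlt, ← hCT, ← hB, rank_mul_mul_transpose_of_orthogonal hU hV]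
  refine ⟨hconv, ?_⟩
  have himage : {B : Matrix (Fin m) (Fin n) ℝ |
      B.rank = r ∧ (A - B)ᵀ * B = 0 ∧ (A - B) * Bᵀ = 0} =
      (fun T => U * sigmaTrunc S T * Vᵀ) ''
        ((Finset.range A.rank).powersetCard r : Set (Finset ℕ)) := by
    ext B
    simp only [Set.mem_ofPred_eq, Set.mem_image, Finset.mem_coe, Finset.mem_powersetCard]
    constructor
    · rintro ⟨hB, h₁, h₂⟩
      obtain ⟨T, hT, hcard, rfl⟩ := hconv B hB h₁ h₂
      exact ⟨T, ⟨fun k hk => Finset.mem_range.mpr (hT k hk), hcard⟩, rfl⟩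
    · rintro ⟨T, ⟨hT, hcard⟩, rfl⟩
      have hsub : A - U * sigmaTrunc S T * Vᵀ = U * (S - sigmaTrunc S T) * Vᵀ := by
        rw [hA, Matrix.mul_sub, Matrix.sub_mul]
      have hdiff : S - sigmaTrunc S T = rectDiag m n (fun k => if k ∈ T then 0 else s k) := by
        rw [htrunc]
        conv_lhs => rw [hS]
        ext i j
        simp only [rectDiag, Matrix.sub_apply, of_apply]
        split_ifs <;> simp
      refine ⟨?_, ?_, ?_⟩
      · rw [rank_mul_mul_transpose_of_orthogonal hU hV,
          hrankT T (fun k hk => Finset.mem_range.mp (hT hk)), hcard]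
      · rw [hsub, transpose_mul_sandwich hU, hdiff, htrunc, rectDiag_transpose,
          rectDiag_mul_rectDiag_eq_zero (fun k => by split_ifs <;> simp)]
        simp
      · rw [hsub, mul_transpose_sandwich U hV, hdiff, htrunc, rectDiag_transpose,
          rectDiag_mul_rectDiag_eq_zero (fun k => by split_ifs <;> simp)]
        simp
  have hinjOn : Set.InjOn (fun T => U * sigmaTrunc S T * Vᵀ)
      ((Finset.range A.rank).powersetCard r : Set (Finset ℕ)) := by
    have hmem_iff (T : Finset ℕ) (hT : T ∈ (Finset.range A.rank).powersetCard r) (k : ℕ) :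
        k ∈ T ↔ zeroExtend (sigmaTrunc S T) k k ≠ 0 := by
      have hlt : k ∈ T → s k ≠ 0 := fun hk =>
        (hmem k).mp (Finset.mem_range.mp ((Finset.mem_powersetCard.mp hT).1 hk))
      by_cases hk : k < m ∧ k < n
      · rw [htrunc]
        simpa [zeroExtend, rectDiag, hk] using hlt
      · simp only [zeroExtend_eq_zero _ hk, ne_eq, not_true_eq_false, iff_false]
        exact fun h => hk (hsupp k (hlt h))
    intro T hT T' hT' h
    have h' : sigmaTrunc S T = sigmaTrunc S T' := sandwich_injective hU hV h
    ext k
    rw [hmem_iff T hT, hmem_iff T' hT', h']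
  rw [himage, hinjOn.ncard_image, Set.ncard_coe_finset, Finset.card_powersetCard,
    Finset.card_range]
end
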